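/- arXiv:1602.00725 — 2 statements merged into one kernel-verified Lean document; each statement's English description precedes it below -/
import Mathlib

section
/- Let d be a pseudometric on ℕ₀³ with λ ∈ (0, 1/4) satisfying the coordinatewise λ-contraction property, and suppose there is no 1-way Cauchy sequence. Let S ⊆ ℕ₀³ be a 2-way set of diameter D (i.e. every s ∈ S has exactly 2 of its three successors s+eᵢ in S). If inf_{s∈S} ρ(s) > D(2+λ), then S contains a quarter-plane, i.e. a set {t + a·e_{i₁} + b·e_{i₂} : a,b ∈ ℕ₀} for some point t and distinct indices i₁ ≠ i₂. -/
/-- The grid ℕ₀³. -/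
abbrev Grid : Type := Fin 3 → ℕ

/-- Standard basis vector eᵢ. -/
def e (i : Fin 3) : Grid := fun j => if j = i then 1 else 0

/-- ρ(x) = max of the three distances to successors. -/
noncomputable def rho (d : Grid → Grid → ℝ) (x : Grid) : ℝ :=
  max (d x (x + e 0)) (max (d x (x + e 1)) (d x (x + e 2)))

/-- A 1-way sequence: consecutive differences are basis vectors. -/
def OneWay (s : ℕ → Grid) : Prop := ∀ n, ∃ i, s (n + 1) = s n + e i

/-- Cauchy with respect to the pseudometric d. -/
def IsCauchySeq (d : Grid → Grid → ℝ) (s : ℕ → Grid) : Prop :=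
  ∀ ε > (0 : ℝ), ∃ N, ∀ m ≥ N, ∀ n ≥ N, d (s m) (s n) < ε

/-- d is a pseudometric. -/
def Pseudo (d : Grid → Grid → ℝ) : Prop :=
  (∀ x, d x x = 0) ∧ (∀ x y, 0 ≤ d x y) ∧ (∀ x y, d x y = d y x) ∧
    (∀ x y z, d x z ≤ d x y + d y z)

/-- The coordinatewise λ-contraction property. -/
def Contractive (d : Grid → Grid → ℝ) (lam : ℝ) : Prop :=
  ∀ a b : Grid, ∃ i : Fin 3, d (a + e i) (b + e i) ≤ lam * d a b

/-- A 2-way set: each element has exactly two of its three successors inside. -/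
def TwoWaySet (S : Set Grid) : Prop :=
  ∀ s ∈ S, ∃ i : Fin 3, s + e i ∉ S ∧ ∀ j : Fin 3, j ≠ i → s + e j ∈ S


structure Ctx (d : Grid → Grid → ℝ) (lam D : ℝ) (S0 : Set Grid) (c : Grid → Fin 3) : Prop where
  h0 : 0 < lam
  h1 : lam < 1/4
  hd : Pseudo d
  hno : ¬ ∃ s : ℕ → Grid, OneWay s ∧ IsCauchySeq d s
  hD : ∀ x ∈ S0, ∀ y ∈ S0, d x y ≤ D
  hP : ∀ x ∈ S0, ∀ y ∈ S0, c x ≠ c y → ∀ k, k ≠ c x → k ≠ c y →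
    d (x + e k) (y + e k) ≤ lam * d x y
  hq : ¬ ∃ (t : Grid) (i₁ i₂ : Fin 3), i₁ ≠ i₂ ∧ ∀ a b : ℕ, t + a • e i₁ + b • e i₂ ∈ S0

/-- Closed nonempty subsystem. -/
structure Sys (S0 : Set Grid) (c : Grid → Fin 3) (S : Set Grid) : Prop where
  sub : S ⊆ S0
  ne : S.Nonempty
  mem : ∀ x ∈ S, ∀ j, x + e j ∈ S ↔ j ≠ c x

/-- Points of `S` with a predecessor in direction `k`. -/
def TT (S : Set Grid) (k : Fin 3) : Set Grid := {u | u ∈ S ∧ ∃ x ∈ S, u = x + e k}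

/-- Points of `S` with a predecessor. -/
def nxt (S : Set Grid) : Set Grid := {u | ∃ k, u ∈ TT S k}

theorem third : ∀ a b k l : Fin 3, a ≠ b → k ≠ a → k ≠ b → l = a ∨ l = b ∨ l = k := by decide

theorem add_swap (x : Grid) (i j : Fin 3) : x + e i + e j = x + e j + e i := add_right_comm _ _ _

theorem add_succ' (x : Grid) (k : Fin 3) (n : ℕ) : x + (n+1) • e k = x + n • e k + e k := by
  rw [succ_nsmul, add_assoc]

theorem cauchy_geo {d : Grid → Grid → ℝ} (hd : Pseudo d) (s : ℕ → Grid) (K r : ℝ) (hr : r < 1)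
    (h : ∀ n, d (s n) (s (n+1)) ≤ K * r ^ n) : IsCauchySeq d s := by
  obtain ⟨a, b, c, t⟩ := hd
  let _ : PseudoMetricSpace Grid :=
    { dist := d, dist_self := a, dist_comm := c, dist_triangle := t }
  have := cauchySeq_of_le_geometric (α := Grid) r K hr (f := s) h
  rw [Metric.cauchySeq_iff] at this
  exact this

section
variable {d : Grid → Grid → ℝ} {lam D : ℝ} {S0 : Set Grid} {c : Grid → Fin 3}

theorem Ctx.no (H : Ctx d lam D S0 c) (s : ℕ → Grid) (hs : OneWay s) (K r : ℝ) (hr : r < 1)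
    (h : ∀ n, d (s n) (s (n+1)) ≤ K * r ^ n) : False :=
  H.hno ⟨s, hs, cauchy_geo H.hd s K r hr h⟩

theorem Ctx.line (H : Ctx d lam D S0 c) (x : Grid) (k : Fin 3) (K r : ℝ) (hr : r < 1)
    (h : ∀ n : ℕ, d (x + n • e k) (x + n • e k + e k) ≤ K * r ^ n) : False := by
  refine H.no (fun n => x + n • e k) (fun n => ⟨k, add_succ' x k n⟩) K r hr ?_
  intro n
  have := h n
  rw [← add_succ'] at this
  exact this

/-- Alternating lines are impossible. -/
theorem Ctx.alt (H : Ctx d lam D S0 c) {S : Set Grid} (hS : Sys S0 c S) (k : Fin 3)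
    (Q : Grid → Prop) (hQ : ∀ x ∈ S, Q x → x + e k ∈ S ∧ Q (x + e k) ∧ c x ≠ c (x + e k))
    (x : Grid) (hx : x ∈ S) (hx' : Q x) : False := by
  have all : ∀ n : ℕ, x + n • e k ∈ S ∧ Q (x + n • e k) := by
    intro n
    induction n with
    | zero => simpa using ⟨hx, hx'⟩
    | succ n ih =>
      rw [add_succ']
      have := hQ _ ih.1 ih.2
      exact ⟨this.1, this.2.1⟩
  refine H.line x k (d x (x + e k)) lam (by linarith [H.h1]) ?_
  intro n
  induction n with
  | zero => simp
  | succ n ih =>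
    obtain ⟨a, b⟩ := all n
    obtain ⟨p, q, r⟩ := hQ _ a b
    obtain ⟨p', -, -⟩ := hQ _ p q
    have := H.hP _ (hS.sub a) _ (hS.sub p) r k ((hS.mem _ a k).1 p) ((hS.mem _ p k).1 p')
    rw [add_succ']
    calc _ ≤ _ := this
      _ ≤ lam * (d x (x + e k) * lam ^ n) := mul_le_mul_of_nonneg_left ih H.h0.le
      _ = _ := by ring

theorem Ctx.colors (H : Ctx d lam D S0 c) {S : Set Grid} (hS : Sys S0 c S) (k : Fin 3) :
    ∃ x ∈ S, c x = k := by
  by_contra hk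
  push Not at hk
  have cl : ∀ x ∈ S, x + e k ∈ S := fun x hx => (hS.mem x hx k).2 (hk x hx).symm
  by_cases two : ∃ x ∈ S, ∃ y ∈ S, c x ≠ c y
  · obtain ⟨x, hx, y, hy, hxy⟩ := two
    have const1 : ∀ x ∈ S, c (x + e k) = c x := by
      intro x hx
      by_contra hne
      have h1 : x + e (c (x + e k)) ∈ S := (hS.mem x hx _).2 hne
      have h2 := cl _ h1
      rw [add_swap] at h2
      exact (hS.mem _ (cl x hx) _).1 h2 rfl
    have const : ∀ x ∈ S, ∀ n : ℕ, x + n • e k ∈ S ∧ c (x + n • e k) = c x := by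
      intro x hx n
      induction n with
      | zero => simpa using hx
      | succ n ih =>
        rw [add_succ']
        exact ⟨cl _ ih.1, (const1 _ ih.1).trans ih.2⟩
    have key : ∀ x ∈ S, ∀ y ∈ S, c x ≠ c y → ∀ n : ℕ,
        d (x + n • e k) (y + n • e k) ≤ D * lam ^ n := by
      intro x hx y hy hxy n
      induction n with
      | zero => simpa using H.hD x (hS.sub hx) y (hS.sub hy)
      | succ n ih =>
        obtain ⟨a, a'⟩ := const x hx n
        obtain ⟨b, b'⟩ := const y hy n
        rw [add_succ', add_succ']
        calc _ ≤ _ := H.hP _ (hS.sub a) _ (hS.sub b) (by rw [a', b']; exact hxy) k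
              (hk _ a).symm (hk _ b).symm
          _ ≤ lam * (D * lam ^ n) := mul_le_mul_of_nonneg_left ih H.h0.le
          _ = _ := by ring
    refine H.line x k (2 * D) lam (by linarith [H.h1]) ?_
    intro n
    have h1 := key x hx y hy hxy n
    have h2 := key (x + e k) (cl x hx) y hy (by rw [const1 x hx]; exact hxy) n
    have h3 := H.hd.2.2.2 (x + n • e k) (y + n • e k) (x + n • e k + e k)
    rw [add_right_comm, H.hd.2.2.1] at h2
    linarith
  · push Not at two
    obtain ⟨t, ht⟩ := hS.ne
    obtain ⟨j, hj, hj'⟩ : ∃ j, j ≠ c t ∧ j ≠ k := by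
      have : ∀ a b : Fin 3, ∃ j, j ≠ a ∧ j ≠ b := by decide
      exact this _ _
    apply H.hq
    refine ⟨t, j, k, hj', ?_⟩
    intro a b
    apply hS.sub
    have cj : ∀ x ∈ S, x + e j ∈ S := fun x hx =>
      (hS.mem x hx j).2 (by rw [two x hx t ht]; exact hj)
    have ha : t + a • e j ∈ S := by
      induction a with
      | zero => simpa using ht
      | succ n ih => rw [add_succ']; exact cj _ ih
    induction b with
    | zero => simpa using ha
    | succ n ih => rw [add_succ']; exact cl _ ih

theorem Sys.nxt {S : Set Grid} (hS : Sys S0 c S) : Sys S0 c (nxt S) := by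
  refine ⟨?_, ?_, ?_⟩
  · rintro x ⟨k, hx, -⟩
    exact hS.sub hx
  · obtain ⟨x, hx⟩ := hS.ne
    obtain ⟨j, hj⟩ : ∃ j, j ≠ c x := by
      have : ∀ a : Fin 3, ∃ j, j ≠ a := by decide
      exact this _
    exact ⟨x + e j, j, (hS.mem x hx j).2 hj, x, hx, rfl⟩
  · rintro x ⟨k, hx, -⟩ j
    rw [← hS.mem x hx j]
    constructor
    · rintro ⟨l, h, -⟩
      exact h
    · intro h
      exact ⟨j, h, x, hx, rfl⟩

theorem nxt_sub (S : Set Grid) : nxt S ⊆ S := by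
  rintro x ⟨k, hx, -⟩
  exact hx

theorem TT_mono {S S' : Set Grid} (h : S' ⊆ S) (k : Fin 3) : TT S' k ⊆ TT S k := by
  rintro x ⟨hx, y, hy, rfl⟩
  exact ⟨h hx, y, h hy, rfl⟩

/-- Points of color `j` are bad if `T i ∩ T k = ∅`. -/
theorem Sys.bad {S : Set Grid} (hS : Sys S0 c S) {i j k : Fin 3} (hij : i ≠ j) (hjk : j ≠ k)
    (hT : ∀ u, u ∈ TT S i → u ∈ TT S k → False) (x : Grid) (hx : x ∈ S)
    (hcx : c x = j) : x + e i ∈ S ∧ c (x + e i) = k := by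
  have h1 : x + e i ∈ S := (hS.mem x hx i).2 (by rw [hcx]; exact hij)
  have h2 : x + e k ∈ S := (hS.mem x hx k).2 (by rw [hcx]; exact hjk.symm)
  refine ⟨h1, ?_⟩
  by_contra hne
  have h3 : x + e i + e k ∈ S := (hS.mem _ h1 k).2 (Ne.symm hne)
  exact hT (x + e i + e k) ⟨h3, x + e k, h2, add_swap _ _ _⟩ ⟨h3, x + e i, h1, rfl⟩

theorem Ctx.two_empty (H : Ctx d lam D S0 c) {S : Set Grid} (hS : Sys S0 c S) {i j k : Fin 3}
    (hij : i ≠ j) (hjk : j ≠ k) (hik : i ≠ k)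
    (h1 : ∀ u, u ∈ TT S i → u ∈ TT S k → False)
    (h2 : ∀ u, u ∈ TT S j → u ∈ TT S k → False) : False := by
  obtain ⟨x, hx, hcx⟩ := H.colors hS j
  refine H.alt hS k (fun x => c x = j ∨ c x = i) ?_ x hx (Or.inl hcx)
  rintro x hx (h | h)
  · have := hS.bad hjk.symm hij.symm (fun u a b => h1 u b a) x hx h
    refine ⟨this.1, Or.inr this.2, ?_⟩
    rw [h, this.2]; exact hij.symm
  · have := hS.bad hik.symm hij (fun u a b => h2 u b a) x hx h
    refine ⟨this.1, Or.inl this.2, ?_⟩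
    rw [h, this.2]; exact hij

theorem Ctx.TTbound (H : Ctx d lam D S0 c) {S : Set Grid} (hS : Sys S0 c S) {C : Set Grid}
    (hCS : C ⊆ S) (hC : ∀ l, ∃ z ∈ C, c z = l) (W : ℝ) (hW : ∀ z ∈ C, ∀ x ∈ S, d z x ≤ W)
    (k : Fin 3) (u v : Grid) (hu : u ∈ TT S k) (hv : v ∈ TT S k) : d u v ≤ 2 * lam * W := by
  obtain ⟨hu, x, hx, rfl⟩ := hu
  obtain ⟨hv, y, hy, rfl⟩ := hv
  have hkx := (hS.mem x hx k).1 hu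
  have hky := (hS.mem y hy k).1 hv
  have h0 := H.h0
  by_cases hxy : c x = c y
  · obtain ⟨j, hj, hj'⟩ : ∃ j, j ≠ c x ∧ k ≠ j := by
      have : ∀ a b : Fin 3, ∃ j, j ≠ a ∧ b ≠ j := by decide
      exact this _ _
    obtain ⟨z, hz, rfl⟩ := hC j
    have a1 := H.hP x (hS.sub hx) z (hS.sub (hCS hz)) hj.symm k hkx hj'
    have a2 := H.hP z (hS.sub (hCS hz)) y (hS.sub hy) (by rw [← hxy]; exact hj) k hj' hky
    have a3 := H.hd.2.2.2 (x + e k) (z + e k) (y + e k)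
    have b1 := hW z hz x hx
    have b2 := hW z hz y hy
    rw [H.hd.2.2.1 x z] at a1
    nlinarith
  · obtain ⟨z, hz, -⟩ := hC k
    have a1 := H.hP x (hS.sub hx) y (hS.sub hy) hxy k hkx hky
    have a3 := H.hd.2.2.2 x z y
    have b1 := hW z hz x hx
    have b2 := hW z hz y hy
    rw [H.hd.2.2.1 x z] at a3
    nlinarith

theorem Ctx.iter (H : Ctx d lam D S0 c) {S : Set Grid} (hS : Sys S0 c S)
    (F : Set Grid → Set Grid) (hF : ∀ S, F S ⊆ S)
    (hC : ∀ S', S' ⊆ S → Sys S0 c S' → ∀ l, ∃ z ∈ F S', c z = l)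
    (hT : ∀ S', S' ⊆ S → Sys S0 c S' → ∀ z ∈ F (nxt S'), ∀ x ∈ nxt S', ∃ w l l',
      z ∈ TT S' l ∧ w ∈ TT S' l ∧ w ∈ TT S' l' ∧ x ∈ TT S' l') : False := by
  have hsys : ∀ n : ℕ, nxt^[n] S ⊆ S ∧ Sys S0 c (nxt^[n] S) := by
    intro n
    induction n with
    | zero => exact ⟨subset_rfl, hS⟩
    | succ n ih =>
      rw [Function.iterate_succ_apply']
      exact ⟨(nxt_sub _).trans ih.1, ih.2.nxt⟩
  have hW : ∀ n : ℕ, ∀ z ∈ F (nxt^[n] S), ∀ x ∈ nxt^[n] S, d z x ≤ D * (4 * lam) ^ n := by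
    intro n
    induction n with
    | zero =>
      intro z hz x hx
      simpa using H.hD z (hS.sub (hF _ hz)) x (hS.sub hx)
    | succ n ih =>
      rw [Function.iterate_succ_apply']
      intro z hz x hx
      obtain ⟨w, l, l', a1, a2, a3, a4⟩ := hT _ (hsys n).1 (hsys n).2 z hz x hx
      have b := H.TTbound (hsys n).2 (hF _) (hC _ (hsys n).1 (hsys n).2) _ ih
      have b1 := b l z w a1 a2
      have b2 := b l' w x a3 a4
      have b3 := H.hd.2.2.2 z w x
      rw [pow_succ]
      linarith
  obtain ⟨x0, hx0⟩ := hS.ne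
  have hstep : ∀ x : Grid, ∃ j, j ≠ c x := by
    intro x
    have : ∀ a : Fin 3, ∃ j, j ≠ a := by decide
    exact this _
  choose f hf using hstep
  let s : ℕ → Grid := fun n => (fun x => x + e (f x))^[n] x0
  have hs : ∀ n, s (n+1) = s n + e (f (s n)) := fun n => Function.iterate_succ_apply' _ _ _
  have hmem : ∀ n, s n ∈ nxt^[n] S := by
    intro n
    induction n with
    | zero => exact hx0
    | succ n ih =>
      rw [Function.iterate_succ_apply', hs]
      exact ⟨_, ((hsys n).2.mem _ ih _).2 (hf _), _, ih, rfl⟩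
  refine H.no s (fun n => ⟨_, hs n⟩) (2 * D) (4 * lam) (by linarith [H.h1]) ?_
  intro n
  obtain ⟨z, hz, -⟩ := hC _ (hsys n).1 (hsys n).2 0
  have h1 := hW n z hz _ (hmem n)
  have h2 := hW n z hz (s (n+1)) (by
    have := hmem (n+1)
    rw [Function.iterate_succ_apply'] at this
    exact nxt_sub _ this)
  have h3 := H.hd.2.2.2 (s n) z (s (n+1))
  rw [H.hd.2.2.1 (s n) z] at h3
  linarith

/-- If every color `k` point `y` has `c (y + e j) = i`, alternating line. -/
theorem Ctx.altB (H : Ctx d lam D S0 c) {S : Set Grid} (hS : Sys S0 c S) {i j k : Fin 3}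
    (hij : i ≠ j) (hjk : j ≠ k) (hik : i ≠ k)
    (h1 : ∀ u, u ∈ TT S i → u ∈ TT S k → False)
    (h2 : ∀ y ∈ S, c y = k → c (y + e j) = i) : False := by
  obtain ⟨x, hx, hcx⟩ := H.colors hS j
  refine H.alt hS i (fun x => c x = j ∨ c x = k) ?_ x hx (Or.inl hcx)
  rintro x hx (h | h)
  · have := hS.bad hij hjk h1 x hx h
    refine ⟨this.1, Or.inr this.2, ?_⟩
    rw [h, this.2]; exact hjk
  · have a := h2 x hx h
    have b1 : x + e i ∈ S := (hS.mem x hx i).2 (by rw [h]; exact hik)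
    have b2 : x + e j ∈ S := (hS.mem x hx j).2 (by rw [h]; exact hjk)
    have b3 : c (x + e i) = j := by
      by_contra hne
      have h3 := (hS.mem _ b1 j).2 (Ne.symm hne)
      rw [add_swap] at h3
      exact (hS.mem _ b2 i).1 h3 a.symm
    refine ⟨b1, Or.inl b3, ?_⟩
    rw [h, b3]; exact hjk.symm

theorem Ctx.color_k (H : Ctx d lam D S0 c) {S : Set Grid} (hS : Sys S0 c S) {i j k : Fin 3}
    (hij : i ≠ j) (hjk : j ≠ k) (hik : i ≠ k)
    (h1 : ∀ u, u ∈ TT S i → u ∈ TT S k → False) : ∃ z ∈ TT S j, c z = k := by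
  by_contra hno
  push Not at hno
  refine H.altB hS hij hjk hik h1 ?_
  intro y hy hcy
  have b1 : y + e i ∈ S := (hS.mem y hy i).2 (by rw [hcy]; exact hik)
  have b2 : y + e j ∈ S := (hS.mem y hy j).2 (by rw [hcy]; exact hjk)
  have b3 : c (y + e j) ≠ k := hno _ ⟨b2, y, hy, rfl⟩
  rcases third i j k (c (y + e j)) hij hik.symm hjk.symm with h | h | h
  · exact h
  · exfalso
    have := hS.bad hij hjk h1 _ b2 h
    rw [add_swap] at this
    exact hno _ ⟨this.1, _, b1, rfl⟩ this.2
  · exact absurd h b3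

theorem Ctx.missing_k (H : Ctx d lam D S0 c) {S : Set Grid} (hS : Sys S0 c S) {i j k : Fin 3}
    (hij : i ≠ j) (hjk : j ≠ k) (hik : i ≠ k)
    (h1 : ∀ u, u ∈ TT S i → u ∈ TT S k → False)
    (hno : ∀ z ∈ TT S j, c z ≠ j) (m : ℕ)
    (hm : ∀ x ∈ S, c x ≠ j → c (x + m • e j) ≠ k) : False := by
  refine H.altB hS hij hjk hik h1 ?_
  intro y hy hcy
  have b2 : y + e j ∈ S := (hS.mem y hy j).2 (by rw [hcy]; exact hjk)
  have b3 : c (y + e j) ≠ j := hno _ ⟨b2, y, hy, rfl⟩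
  rcases third i j k (c (y + e j)) hij hik.symm hjk.symm with h | h | h
  · exact h
  · exact absurd h b3
  · exfalso
    have all : ∀ n : ℕ, y + n • e j ∈ S ∧ c (y + n • e j) = k ∧ c (y + n • e j + e j) = k := by
      intro n
      induction n with
      | zero => simpa using ⟨hy, hcy, h⟩
      | succ n ih =>
        rw [add_succ']
        obtain ⟨p, q, r⟩ := ih
        generalize y + n • e j = v at p q r
        have p1 : v + e j ∈ S := (hS.mem v p j).2 (by rw [q]; exact hjk)
        have p2 : v + e j + e j ∈ S := (hS.mem _ p1 j).2 (by rw [r]; exact hjk)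
        refine ⟨p1, r, ?_⟩
        rcases third i j k (c (v + e j + e j)) hij hik.symm hjk.symm with h | h | h
        · exfalso
          have q1 : v + e j + e i ∈ S := (hS.mem _ p1 i).2 (by rw [r]; exact hik)
          have q2 : v + e i ∈ S := (hS.mem _ p i).2 (by rw [q]; exact hik)
          have q3 : c (v + e j + e i) ≠ j := hno _ ⟨q1, v + e i, q2, add_swap _ _ _⟩
          have q4 := (hS.mem _ q1 j).2 q3.symm
          rw [add_swap] at q4
          exact (hS.mem _ p2 i).1 q4 h.symm
        · exact absurd h (hno _ ⟨p2, _, p1, rfl⟩)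
        · exact h
    exact hm y hy (by rw [hcy]; exact hjk.symm) (all m).2.1

theorem Ctx.color_j (H : Ctx d lam D S0 c) {S : Set Grid} (hS : Sys S0 c S) {i j k : Fin 3}
    (hij : i ≠ j) (hjk : j ≠ k) (hik : i ≠ k)
    (h1 : ∀ u, u ∈ TT S i → u ∈ TT S k → False) : ∃ z ∈ TT S j, c z = j := by
  by_contra hno
  push Not at hno
  have hk : ∀ m : ℕ, ∃ x ∈ S, c x ≠ j ∧ c (x + m • e j) = k := by
    intro m
    by_contra hh
    push Not at hh
    exact H.missing_k hS hij hjk hik h1 hno m hh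
  have hi : ∀ m : ℕ, ∃ x ∈ S, c x ≠ j ∧ c (x + m • e j) = i := by
    intro m
    by_contra hh
    push Not at hh
    exact H.missing_k hS hjk.symm hij.symm hik.symm (fun u a b => h1 u b a) hno m hh
  have cl : ∀ x ∈ S, c x ≠ j → ∀ n : ℕ, x + n • e j ∈ S ∧ c (x + n • e j) ≠ j := by
    intro x hx hcx n
    induction n with
    | zero => simpa using ⟨hx, hcx⟩
    | succ n ih =>
      rw [add_succ']
      have : x + n • e j + e j ∈ S := (hS.mem _ ih.1 j).2 ih.2.symm
      exact ⟨this, hno _ ⟨this, _, ih.1, rfl⟩⟩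
  have key : ∀ n : ℕ, ∀ x ∈ S, c x ≠ j → ∀ y ∈ S, c y ≠ j →
      d (x + n • e j) (y + n • e j) ≤ D * (2 * lam) ^ n := by
    intro n
    induction n with
    | zero =>
      intro x hx _ y hy _
      simpa using H.hD x (hS.sub hx) y (hS.sub hy)
    | succ n ih =>
      intro x hx hcx y hy hcy
      rw [add_succ', add_succ']
      have h0 := H.h0
      have hDn : 0 ≤ D * (2 * lam) ^ n := (H.hd.2.1 _ _).trans (ih x hx hcx x hx hcx)
      obtain ⟨ax, bx⟩ := cl x hx hcx n
      obtain ⟨ay, bny⟩ := cl y hy hcy n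
      have ixy := ih x hx hcx y hy hcy
      rw [pow_succ]
      by_cases hxy : c (x + n • e j) = c (y + n • e j)
      · obtain ⟨z, hz, hcz, hcz'⟩ : ∃ z ∈ S, c z ≠ j ∧ c (z + n • e j) ≠ c (x + n • e j) := by
          by_cases hci : c (x + n • e j) = i
          · obtain ⟨z, a, b, h⟩ := hk n
            exact ⟨z, a, b, by rw [h, hci]; exact hik.symm⟩
          · obtain ⟨z, a, b, h⟩ := hi n
            exact ⟨z, a, b, by rw [h]; exact Ne.symm hci⟩
        obtain ⟨az, bz⟩ := cl z hz hcz n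
        have a1 := H.hP _ (hS.sub ax) _ (hS.sub az) hcz'.symm j bx.symm bz.symm
        have a2 := H.hP _ (hS.sub az) _ (hS.sub ay) (by rw [← hxy]; exact hcz') j bz.symm bny.symm
        have a3 := H.hd.2.2.2 (x + n • e j + e j) (z + n • e j + e j) (y + n • e j + e j)
        have i1 := ih x hx hcx z hz hcz
        have i2 := ih z hz hcz y hy hcy
        nlinarith
      · have a1 := H.hP _ (hS.sub ax) _ (hS.sub ay) hxy j bx.symm bny.symm
        nlinarith
  obtain ⟨x, hx, hcx, -⟩ := hk 0
  refine H.line x j D (2 * lam) (by linarith [H.h1]) ?_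
  intro n
  have h := cl x hx hcx 1
  rw [one_nsmul] at h
  have := key n x hx hcx (x + e j) h.1 h.2
  rwa [add_right_comm] at this

theorem Ctx.caseB (H : Ctx d lam D S0 c) {S : Set Grid} (hS : Sys S0 c S) {i j k : Fin 3}
    (hij : i ≠ j) (hjk : j ≠ k) (hik : i ≠ k)
    (h1 : ∀ u, u ∈ TT S i → u ∈ TT S k → False) : False := by
  refine H.iter hS (fun S => TT S j) (fun S x hx => hx.1) ?_ ?_
  · intro S' hsub hS' l
    have h1' : ∀ u, u ∈ TT S' i → u ∈ TT S' k → False := fun u a b =>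
      h1 u (TT_mono hsub _ a) (TT_mono hsub _ b)
    rcases third i j k l hij hik.symm hjk.symm with rfl | rfl | rfl
    · exact H.color_k hS' hjk.symm hij.symm hik.symm (fun u a b => h1' u b a)
    · exact H.color_j hS' hij hjk hik h1'
    · exact H.color_k hS' hij hjk hik h1'
  · intro S' hsub hS' z hz x hx
    have h1' : ∀ u, u ∈ TT S' i → u ∈ TT S' k → False := fun u a b =>
      h1 u (TT_mono hsub _ a) (TT_mono hsub _ b)
    have hz' := TT_mono (nxt_sub S') j hz
    obtain ⟨l, hl⟩ := hx
    obtain ⟨w, hw, hw'⟩ : ∃ w, w ∈ TT S' j ∧ w ∈ TT S' l := by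
      by_contra hcon
      push Not at hcon
      rcases third i j k l hij hik.symm hjk.symm with rfl | rfl | rfl
      · exact H.two_empty hS' hjk.symm hij.symm hik.symm (fun u a b => h1' u b a) hcon
      · exact hcon z hz' hz'
      · exact H.two_empty hS' hij hjk hik h1' hcon
    exact ⟨w, j, l, hz', hw, hw', hl⟩

theorem Ctx.final (H : Ctx d lam D S0 c) (hS : Sys S0 c S0) : False := by
  refine H.iter hS (fun S => S) (fun S => subset_rfl) ?_ ?_
  · intro S' _ hS' l
    exact H.colors hS' l
  · rintro S' _ hS' z ⟨l, hz⟩ x ⟨l', hx⟩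
    by_cases hll : l = l'
    · subst hll
      exact ⟨z, l, l, hz, hz, hz, hx⟩
    obtain ⟨w, hw, hw'⟩ : ∃ w, w ∈ TT S' l ∧ w ∈ TT S' l' := by
      by_contra hcon
      push Not at hcon
      obtain ⟨j, hj, hj'⟩ : ∃ j, l ≠ j ∧ j ≠ l' := by
        have : ∀ a b : Fin 3, ∃ j, a ≠ j ∧ j ≠ b := by decide
        exact this _ _
      exact H.caseB hS' hj hj' hll hcon
    exact ⟨w, l, l', hz, hw, hw', hx⟩

end

theorem stmt10 (d : Grid → Grid → ℝ) (lam : ℝ) (h0 : 0 < lam) (h1 : lam < 1/4)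
    (hd : Pseudo d) (hc : Contractive d lam)
    (hno : ¬ ∃ s : ℕ → Grid, OneWay s ∧ IsCauchySeq d s)
    (S : Set Grid) (hS2 : TwoWaySet S) (D : ℝ)
    (hD : ∀ x ∈ S, ∀ y ∈ S, d x y ≤ D)
    (m : ℝ) (hm : IsGLB (rho d '' S) m) (hmD : m > D * (2 + lam)) :
    ∃ (t : Grid) (i₁ i₂ : Fin 3), i₁ ≠ i₂ ∧
      ∀ a b : ℕ, t + a • e i₁ + b • e i₂ ∈ S := by
  by_contra hq
  have hne : S.Nonempty := by
    by_contra h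
    rw [Set.not_nonempty_iff_eq_empty] at h
    subst h
    have : m + 1 ≤ m := hm.2 (by simp [lowerBounds])
    linarith
  have hcol : ∀ s : Grid, ∃ i : Fin 3, s ∈ S → ∀ j, s + e j ∈ S ↔ j ≠ i := by
    intro s
    by_cases hs : s ∈ S
    · obtain ⟨i, hi, hj⟩ := hS2 s hs
      refine ⟨i, fun _ j => ⟨?_, hj j⟩⟩
      rintro h rfl
      exact hi h
    · exact ⟨0, fun h => absurd h hs⟩
  choose c hcc using hcol
  have hsys : Sys S c S := ⟨subset_rfl, hne, hcc⟩
  have hDnn : 0 ≤ D := by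
    obtain ⟨x, hx⟩ := hne
    exact (hd.2.1 x x).trans (hD x hx x hx)
  have far : ∀ x ∈ S, ∀ y ∈ S, y + e (c x) ∈ S →
      ¬ d (x + e (c x)) (y + e (c x)) ≤ lam * d x y := by
    intro x hx y hy hy' hle
    have hr : m ≤ rho d x := hm.1 ⟨x, hx, rfl⟩
    have hxy := hD x hx y hy
    have hb : ∀ j, d x (x + e j) ≤ D + lam * D := by
      intro j
      by_cases hj : j = c x
      · subst hj
        have t := hd.2.2.2 x (y + e (c x)) (x + e (c x))
        have t2 := hD x hx _ hy'
        rw [hd.2.2.1 (y + e (c x))] at t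
        nlinarith
      · have := hD x hx _ ((hcc x hx j).2 hj)
        nlinarith
    have : rho d x ≤ D + lam * D := max_le (hb 0) (max_le (hb 1) (hb 2))
    nlinarith
  refine Ctx.final (d := d) (lam := lam) (D := D) (S0 := S) (c := c)
    ⟨h0, h1, hd, hno, hD, ?_, hq⟩ hsys
  intro x hx y hy hxy k hkx hky
  obtain ⟨l, hl⟩ := hc x y
  rcases third (c x) (c y) k l hxy hkx hky with rfl | rfl | rfl
  · exact absurd hl (far x hx y hy ((hcc y hy _).2 hxy))
  · exfalso
    apply far y hy x hx ((hcc x hx _).2 hxy.symm)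
    rw [hd.2.2.1, hd.2.2.1 y x]
    exact hl
  · exact hl
end

section
/- Let d be a pseudometric on ℕ₀³ with λ < 1/9 satisfying the coordinatewise λ-contraction property and admitting no 1-way Cauchy sequence. Suppose S is a 2-way set of diameter D and R = inf_{s∈S} ρ(s) satisfies R > (2+λ)D. Then there exists a 3-way set of diameter at most 6λR. -/
lemma third_dir : ∀ i j : Fin 3, ∃ k, k ≠ i ∧ k ≠ j := by decide

lemma dir_cases : ∀ i j k l : Fin 3, i ≠ j → k ≠ i → k ≠ j → l = i ∨ l = j ∨ l = k := by decide

lemma cauchy_of_geom (d : Grid → Grid → ℝ) (hd : Pseudo d) (x : ℕ → Grid) (C r : ℝ)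
    (hr0 : 0 ≤ r) (hr1 : r < 1) (h : ∀ n, d (x n) (x (n+1)) ≤ C * r ^ n) : IsCauchySeq d x := by
  obtain ⟨z, nn, sy, tr⟩ := hd
  have hC : 0 ≤ C := by
    have := h 0
    have := nn (x 0) (x 1)
    simp at *
    linarith
  have key : ∀ N k, d (x N) (x (N+k)) ≤ C * r ^ N * (1 - r ^ k) / (1 - r) := by
    intro N k
    have h1r : 0 < 1 - r := by linarith
    induction k with
    | zero => simp [z]
    | succ k ih =>
      have a := tr (x N) (x (N+k)) (x (N+k+1))
      have b := h (N+k)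
      have : C * r ^ N * (1 - r ^ (k+1)) / (1 - r) =
        C * r ^ N * (1 - r ^ k) / (1 - r) + C * r ^ (N+k) := by
        field_simp
        ring
      rw [this]
      exact a.trans (add_le_add ih b)
  have key2 : ∀ N k, d (x N) (x (N+k)) ≤ C / (1 - r) * r ^ N := by
    intro N k
    have h1r : 0 < 1 - r := by linarith
    refine (key N k).trans ?_
    rw [div_mul_eq_mul_div]
    apply div_le_div_of_nonneg_right _ h1r.le
    have : 0 ≤ C * r ^ N := by positivity
    have : 0 ≤ r ^ k := by positivity
    nlinarith
  intro ε hε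
  have lim : Filter.Tendsto (fun N => C / (1 - r) * r ^ N) Filter.atTop (nhds 0) := by
    simpa using (tendsto_pow_atTop_nhds_zero_of_lt_one hr0 hr1).const_mul (C / (1 - r))
  obtain ⟨N, hN⟩ := (lim.eventually (gt_mem_nhds (half_pos hε))).exists
  refine ⟨N, fun m hm n hn => ?_⟩
  obtain ⟨a, rfl⟩ := Nat.exists_eq_add_of_le hm
  obtain ⟨b, rfl⟩ := Nat.exists_eq_add_of_le hn
  have := tr (x (N+a)) (x N) (x (N+b))
  have := sy (x (N+a)) (x N)
  have := key2 N a
  have := key2 N b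
  linarith

/-- Colouring data of a 2-way set: the missing direction, and contraction of bichromatic pairs. -/
structure ColData (d : Grid → Grid → ℝ) (lam : ℝ) (S : Set Grid) (c : Grid → Fin 3) : Prop where
  out : ∀ s ∈ S, s + e (c s) ∉ S
  ins : ∀ s ∈ S, ∀ j, j ≠ c s → s + e j ∈ S
  con : ∀ s ∈ S, ∀ t ∈ S, c s ≠ c t → ∀ k, k ≠ c s → k ≠ c t →
    d (s + e k) (t + e k) ≤ lam * d s t

/-- A subset closed under the successors in the ambient 2-way set. -/
def ClosedSub (c : Grid → Fin 3) (T : Set Grid) : Prop := ∀ s ∈ T, ∀ j, j ≠ c s → s + e j ∈ T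

/-- The set of successors. -/
def Succs (c : Grid → Fin 3) (T : Set Grid) : Set Grid :=
  {y | ∃ s ∈ T, ∃ j, j ≠ c s ∧ y = s + e j}

lemma succs_sub {c : Grid → Fin 3} {T : Set Grid} (h : ClosedSub c T) : Succs c T ⊆ T := by
  rintro y ⟨s, hs, j, hj, rfl⟩
  exact h s hs j hj

lemma succs_closed {c : Grid → Fin 3} {T : Set Grid} (h : ClosedSub c T) :
    ClosedSub c (Succs c T) := by
  intro y hy j hj
  exact ⟨y, succs_sub h hy, j, hj, rfl⟩

section
variable {d : Grid → Grid → ℝ} {lam : ℝ} {S : Set Grid} {c : Grid → Fin 3}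

lemma ColData.ne (H : ColData d lam S c) {s : Grid} (hs : s ∈ S) {j : Fin 3}
    (h : s + e j ∈ S) : c s ≠ j := by
  rintro rfl
  exact H.out s hs h

lemma mono_of_succs (H : ColData d lam S c) {T : Set Grid} (hTS : T ⊆ S) (hT : ClosedSub c T)
    (r : Fin 3) (hr : ∀ s ∈ Succs c T, c s = r) : ∀ s ∈ T, c s = r := by
  intro s hs
  by_contra hne
  obtain ⟨m, hm1, hm2⟩ := third_dir (c s) r
  have a : c (s + e m) = r := hr _ ⟨s, hs, m, hm1, rfl⟩
  have b : c (s + e r) = r := hr _ ⟨s, hs, r, Ne.symm hne, rfl⟩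
  have h1 : s + e m + e r ∉ S := by
    have := H.out _ (hTS (hT s hs m hm1))
    rwa [a] at this
  have h2 : s + e r + e m ∈ S :=
    H.ins _ (hTS (hT s hs r (Ne.symm hne))) m (by rw [b]; exact hm2)
  rw [add_right_comm] at h2
  exact h1 h2

lemma bicolor_absurd (hd : Pseudo d) (h0 : 0 < lam) (h1 : lam < 1)
    (hno : ¬ ∃ s : ℕ → Grid, OneWay s ∧ IsCauchySeq d s)
    (H : ColData d lam S c) {T : Set Grid} (hTS : T ⊆ S) (hT : ClosedSub c T) {D : ℝ}
    (hD : ∀ x ∈ S, ∀ y ∈ S, d x y ≤ D)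
    (k : Fin 3) (hk : ∀ s ∈ T, c s ≠ k) (s t : Grid) (hs : s ∈ T) (ht : t ∈ T)
    (hst : c s ≠ c t) : False := by
  have hcl : ∀ s ∈ T, s + e k ∈ T := fun s hs => hT s hs k (hk s hs).symm
  have hcol : ∀ s ∈ T, c (s + e k) = c s := by
    intro s hs
    obtain ⟨m, hm1, hm2⟩ := third_dir (c s) k
    have a : s + e m ∈ T := hT s hs m hm1
    have b : s + e k + e m ∈ S := by
      rw [add_right_comm]; exact hTS (hcl _ a)
    have b' := H.ne (hTS (hcl s hs)) b
    have b2 := hk _ (hcl s hs)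
    rcases dir_cases (c s) k m (c (s + e k)) (hk s hs) hm1 hm2 with h | h | h
    · exact h
    · exact absurd h b2
    · exact absurd h b'
  have hn : ∀ n : ℕ, ∀ s ∈ T, s + n • e k ∈ T ∧ c (s + n • e k) = c s := by
    intro n
    induction n with
    | zero => intro s hs; simpa using hs
    | succ n ih =>
      intro s hs
      obtain ⟨a, b⟩ := ih s hs
      rw [succ_nsmul, ← add_assoc]
      exact ⟨hcl _ a, (hcol _ a).trans b⟩
  have hdist : ∀ n : ℕ, ∀ s ∈ T, ∀ t ∈ T, c s ≠ c t →
      d (s + n • e k) (t + n • e k) ≤ D * lam ^ n := by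
    intro n s hs t ht hst
    induction n with
    | zero => simpa using hD _ (hTS hs) _ (hTS ht)
    | succ n ih =>
      obtain ⟨a, b⟩ := hn n s hs
      obtain ⟨a', b'⟩ := hn n t ht
      have := H.con _ (hTS a) _ (hTS a') (by rw [b, b']; exact hst) k (hk _ a).symm (hk _ a').symm
      rw [succ_nsmul, ← add_assoc, ← add_assoc]
      refine this.trans ?_
      rw [pow_succ]
      nlinarith
  apply hno
  refine ⟨fun n => s + n • e k, fun n => ⟨k, ?_⟩, ?_⟩
  · simp only [succ_nsmul, ← add_assoc]
  · apply cauchy_of_geom d hd _ (2 * D) lam h0.le h1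
    intro n
    have a := hdist n (s + e k) (hcl s hs) t ht (by rw [hcol s hs]; exact hst)
    have b := hdist n s hs t ht hst
    have e1 : s + (n+1) • e k = s + e k + n • e k := by
      rw [succ_nsmul', ← add_assoc]
    have := hd.2.2.2 (s + n • e k) (t + n • e k) (s + (n+1) • e k)
    have sy := hd.2.2.1 (t + n • e k) (s + (n+1) • e k)
    rw [e1] at *
    linarith

/-- The sets `U i` and `U j` meet. -/
def Link (c : Grid → Fin 3) (T : Set Grid) (i j : Fin 3) : Prop :=
  ∃ a ∈ T, ∃ b ∈ T, c a ≠ i ∧ c b ≠ j ∧ a + e i = b + e j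

lemma Link.symm {T : Set Grid} {i j : Fin 3} (h : Link c T i j) : Link c T j i := by
  obtain ⟨a, ha, b, hb, h1, h2, h3⟩ := h
  exact ⟨b, hb, a, ha, h2, h1, h3.symm⟩

lemma color_of_not_link (H : ColData d lam S c) {T : Set Grid} (hTS : T ⊆ S)
    (hT : ClosedSub c T) {i j k : Fin 3} (hij : i ≠ j) (hki : k ≠ i) (hkj : k ≠ j)
    (h : ¬ Link c T i j) (x : Grid) (hx : x ∈ T) (hc : c x = k) : c (x + e i) = j := by
  by_contra hne
  have a : x + e i ∈ T := hT x hx i (by rw [hc]; exact hki.symm)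
  have b : x + e j ∈ T := hT x hx j (by rw [hc]; exact hkj.symm)
  apply h
  refine ⟨x + e j, b, x + e i, a, ?_, hne, add_right_comm _ _ _⟩
  apply H.ne (hTS b)
  rw [add_right_comm]
  exact H.ins _ (hTS a) j (Ne.symm hne)

lemma link_exists (hd : Pseudo d) (h0 : 0 < lam) (h1 : lam < 1)
    (hno : ¬ ∃ s : ℕ → Grid, OneWay s ∧ IsCauchySeq d s)
    (H : ColData d lam S c) {T : Set Grid} (hTS : T ⊆ S) (hT : ClosedSub c T)
    (htri : ∀ k, ∃ s ∈ T, c s = k) {i j k : Fin 3} (hij : i ≠ j) (hki : k ≠ i) (hkj : k ≠ j)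
    (hj : ¬ Link c T i j) (hk : ¬ Link c T i k) : False := by
  obtain ⟨x, hx, hxk⟩ := htri k
  have hcl : ∀ s ∈ T, (c s = k → c (s + e i) = j) ∧ (c s = j → c (s + e i) = k) := fun s hs =>
    ⟨color_of_not_link H hTS hT hij hki hkj hj s hs,
     color_of_not_link H hTS hT hki.symm hij.symm hkj.symm hk s hs⟩
  have hn : ∀ n : ℕ, x + n • e i ∈ T ∧ (c (x + n • e i) = k ∨ c (x + n • e i) = j) := by
    intro n
    induction n with
    | zero => simp [hx, hxk]
    | succ n ih =>
      obtain ⟨a, b⟩ := ih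
      rw [succ_nsmul, ← add_assoc]
      rcases b with b | b
      · exact ⟨hT _ a i (by rw [b]; exact hki.symm), Or.inr ((hcl _ a).1 b)⟩
      · exact ⟨hT _ a i (by rw [b]; exact hij), Or.inl ((hcl _ a).2 b)⟩
  apply hno
  refine ⟨fun n => x + n • e i, fun n => ⟨i, ?_⟩, ?_⟩
  · simp only [succ_nsmul, ← add_assoc]
  · apply cauchy_of_geom d hd _ (d x (x + e i)) lam h0.le h1
    intro n
    induction n with
    | zero => simp
    | succ n ih =>
      obtain ⟨a, b⟩ := hn n
      have a' := (hn (n+1)).1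
      have hcon : d (x + n • e i + e i) (x + (n+1) • e i + e i) ≤
          lam * d (x + n • e i) (x + (n+1) • e i) := by
        have e1 : x + (n+1) • e i = x + n • e i + e i := by rw [succ_nsmul, ← add_assoc]
        rcases b with b | b
        · have b2 := (hcl _ a).1 b
          rw [← e1] at b2
          exact H.con _ (hTS a) _ (hTS a') (by rw [b, b2]; exact hkj) i
            (by rw [b]; exact hki.symm) (by rw [b2]; exact hij)
        · have b2 := (hcl _ a).2 b
          rw [← e1] at b2
          exact H.con _ (hTS a) _ (hTS a') (by rw [b, b2]; exact hkj.symm) i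
            (by rw [b]; exact hij) (by rw [b2]; exact hki.symm)
      have e1 : x + (n+1) • e i = x + n • e i + e i := by rw [succ_nsmul, ← add_assoc]
      have e2 : x + (n+1+1) • e i = x + (n+1) • e i + e i := by
        rw [succ_nsmul _ (n+1), ← add_assoc]
      show d (x + (n+1) • e i) (x + (n+1+1) • e i) ≤ _
      rw [e2]
      conv_lhs => rw [e1]
      rw [← e1]
      rw [← e1] at hcon
      refine hcon.trans ?_
      rw [pow_succ]
      nlinarith

lemma succs_diam (hd : Pseudo d) (h0 : 0 < lam) (h1 : lam < 1)
    (hno : ¬ ∃ s : ℕ → Grid, OneWay s ∧ IsCauchySeq d s)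
    (H : ColData d lam S c) {T : Set Grid} (hTS : T ⊆ S) (hT : ClosedSub c T)
    (htri : ∀ k, ∃ s ∈ T, c s = k) {M : ℝ} (hM : ∀ x ∈ T, ∀ y ∈ T, d x y ≤ M) :
    ∀ x ∈ Succs c T, ∀ y ∈ Succs c T, d x y ≤ M * (6 * lam) := by
  obtain ⟨z, nn, sy, tr⟩ := id hd
  have hM0 : 0 ≤ M := by
    obtain ⟨s, hs, -⟩ := htri 0
    exact (nn s s).trans (hM s hs s hs)
  have hdiff : ∀ i, ∀ s ∈ T, ∀ t ∈ T, c s ≠ i → c t ≠ i → c s ≠ c t →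
      d (s + e i) (t + e i) ≤ lam * M := fun i s hs t ht hsi hti hst =>
    (H.con s (hTS hs) t (hTS ht) hst i hsi.symm hti.symm).trans
      (mul_le_mul_of_nonneg_left (hM s hs t ht) h0.le)
  have hU : ∀ i, ∀ s ∈ T, ∀ t ∈ T, c s ≠ i → c t ≠ i →
      d (s + e i) (t + e i) ≤ 2 * (lam * M) := by
    intro i s hs t ht hsi hti
    by_cases hst : c s = c t
    · obtain ⟨m, hm1, hm2⟩ := third_dir (c s) i
      obtain ⟨u, hu, hum⟩ := htri m
      have a := hdiff i s hs u hu hsi (by rw [hum]; exact hm2) (by rw [hum]; exact hm1.symm)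
      have b := hdiff i u hu t ht (by rw [hum]; exact hm2) hti (by rw [hum, ← hst]; exact hm1)
      have := tr (s + e i) (u + e i) (t + e i)
      linarith
    · have := hdiff i s hs t ht hsi hti hst
      have : 0 ≤ lam * M := by positivity
      linarith
  have hpos : 0 ≤ lam * M := by positivity
  have hlink : ∀ i j, Link c T i j → ∀ s ∈ T, ∀ t ∈ T, c s ≠ i → c t ≠ j →
      d (s + e i) (t + e j) ≤ 4 * (lam * M) := by
    rintro i j ⟨a, ha, b, hb, hai, hbj, hab⟩ s hs t ht hsi htj
    have h1 := hU i s hs a ha hsi hai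
    have h2 := hU j b hb t ht hbj htj
    rw [← hab] at h2
    have := tr (s + e i) (a + e i) (t + e j)
    linarith
  rintro _ ⟨s, hs, i, hi, rfl⟩ _ ⟨t, ht, j, hj, rfl⟩
  by_cases hij : i = j
  · subst hij
    have := hU i s hs t ht hi.symm hj.symm
    linarith
  · by_cases hl : Link c T i j
    · have := hlink i j hl s hs t ht hi.symm hj.symm
      linarith
    · obtain ⟨k, hki, hkj⟩ := third_dir i j
      have l1 : Link c T i k := by
        by_contra hk
        exact link_exists hd h0 h1 hno H hTS hT htri hij hki hkj hl hk
      have l2 : Link c T j k := by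
        by_contra hk
        exact link_exists hd h0 h1 hno H hTS hT htri (Ne.symm hij) hkj hki
          (fun h => hl h.symm) hk
      obtain ⟨a, ha, b, hb, hai, hbk, hab⟩ := l1
      have x1 := hU i s hs a ha hi.symm hai
      have x2 := hlink k j l2.symm b hb t ht hbk hj.symm
      rw [← hab] at x2
      have := tr (s + e i) (a + e i) (t + e j)
      linarith

lemma mono_all (hd : Pseudo d) (h0 : 0 < lam) (h1 : lam < 1/9)
    (hno : ¬ ∃ s : ℕ → Grid, OneWay s ∧ IsCauchySeq d s)
    (H : ColData d lam S c) (hne : S.Nonempty) {D : ℝ}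
    (hD : ∀ x ∈ S, ∀ y ∈ S, d x y ≤ D) : ∃ r, ∀ s ∈ S, c s = r := by
  by_contra hmono
  have hl1 : lam < 1 := by linarith
  let T : ℕ → Set Grid := fun n => (Succs c)^[n] S
  have hT0 : T 0 = S := rfl
  have hTs : ∀ n, T (n+1) = Succs c (T n) := fun n => Function.iterate_succ_apply' _ _ _
  have hcl : ∀ n, ClosedSub c (T n) := by
    intro n
    induction n with
    | zero => exact H.ins
    | succ n ih => rw [hTs]; exact succs_closed ih
  have hsub1 : ∀ n, T (n+1) ⊆ T n := fun n => by rw [hTs]; exact succs_sub (hcl n)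
  have hsub : ∀ n, T n ⊆ S := by
    intro n
    induction n with
    | zero => exact subset_rfl
    | succ n ih => exact (hsub1 n).trans ih
  have hnm : ∀ n, ¬ ∃ r, ∀ s ∈ T n, c s = r := by
    intro n
    induction n with
    | zero => exact hmono
    | succ n ih =>
      rintro ⟨r, hr⟩
      rw [hTs] at hr
      exact ih ⟨r, mono_of_succs H (hsub n) (hcl n) r hr⟩
  have htri : ∀ n k, ∃ s ∈ T n, c s = k := by
    intro n k
    by_contra hk
    push Not at hk
    have hnn : (T n).Nonempty := by
      by_contra h
      rw [Set.not_nonempty_iff_eq_empty] at h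
      exact hnm n ⟨0, by simp [h]⟩
    obtain ⟨s, hs⟩ := hnn
    have : ∃ t ∈ T n, c t ≠ c s := by
      by_contra h
      push Not at h
      exact hnm n ⟨_, h⟩
    obtain ⟨t, ht, hts⟩ := this
    exact bicolor_absurd hd h0 hl1 hno H (hsub n) (hcl n) hD k hk t s ht hs hts
  have hdiam : ∀ n, ∀ x ∈ T n, ∀ y ∈ T n, d x y ≤ D * (6 * lam) ^ n := by
    intro n
    induction n with
    | zero => simpa [hT0] using hD
    | succ n ih =>
      rw [hTs, pow_succ, ← mul_assoc]
      exact succs_diam hd h0 hl1 hno H (hsub n) (hcl n) (htri n) ih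
  obtain ⟨x0, hx0⟩ := hne
  choose f hf1 _ using third_dir
  let x : ℕ → Grid := fun n => (fun y => y + e (f (c y) (c y)))^[n] x0
  have hxs : ∀ n, x (n+1) = x n + e (f (c (x n)) (c (x n))) :=
    fun n => Function.iterate_succ_apply' _ _ _
  have hxT : ∀ n, x n ∈ T n := by
    intro n
    induction n with
    | zero => exact hx0
    | succ n ih => rw [hTs, hxs]; exact ⟨x n, ih, _, hf1 _ _, rfl⟩
  apply hno
  refine ⟨x, fun n => ⟨_, hxs n⟩, cauchy_of_geom d hd x D (6 * lam) (by linarith) (by linarith) ?_⟩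
  intro n
  exact hdiam n _ (hxT n) _ (hsub1 n (hxT (n+1)))

end

lemma grid_induct (P : Grid → Prop) (hP : ∀ x, P x → ∀ i, P (x + e i)) (x : Grid) (hx : P x)
    (k : Grid) : P (x + k) := by
  have h1 : ∀ n : ℕ, ∀ i x, P x → P (x + n • e i) := by
    intro n i
    induction n with
    | zero => intro x hx; simpa using hx
    | succ n ih => intro x hx; rw [succ_nsmul, ← add_assoc]; exact hP _ (ih x hx) i
  have : x + k = x + k 0 • e 0 + k 1 • e 1 + k 2 • e 2 := by
    ext j
    fin_cases j <;> simp [e]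
  rw [this]
  exact h1 _ _ _ (h1 _ _ _ (h1 _ _ _ hx))

theorem stmt12 (d : Grid → Grid → ℝ) (lam : ℝ) (h0 : 0 < lam) (h1 : lam < 1/9)
    (hd : Pseudo d) (hc : Contractive d lam)
    (hno : ¬ ∃ s : ℕ → Grid, OneWay s ∧ IsCauchySeq d s)
    (S : Set Grid) (hS2 : TwoWaySet S) (D R : ℝ)
    (hD : ∀ x ∈ S, ∀ y ∈ S, d x y ≤ D)
    (hR : IsGLB (rho d '' S) R) (hRD : R > (2 + lam) * D) :
    ∃ β : Grid, ∀ k k' : Grid, d (β + k) (β + k') ≤ 6 * lam * R := by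
  obtain ⟨z, nn, sy, tr⟩ := id hd
  have hne : S.Nonempty := by
    by_contra h
    rw [Set.not_nonempty_iff_eq_empty] at h
    subst h
    have : R + 1 ≤ R := hR.2 (by simp [lowerBounds])
    linarith
  have hD0 : 0 ≤ D := by
    obtain ⟨s, hs⟩ := hne
    exact (nn s s).trans (hD s hs s hs)
  have hlD : 0 ≤ lam * D := by positivity
  have hDR : 2 * D + lam * D < R := by linarith
  choose! c hc1 hc2 using hS2
  have hrho : ∀ s ∈ S, rho d s = d s (s + e (c s)) ∧ R ≤ d s (s + e (c s)) := by
    intro s hs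
    have a : R ≤ rho d s := hR.1 ⟨s, hs, rfl⟩
    have b : ∀ j, j ≠ c s → d s (s + e j) ≤ D := fun j hj => hD s hs _ (hc2 s hs j hj)
    have hle : rho d s ≤ d s (s + e (c s)) := by
      have e1 : ∃ i, rho d s = d s (s + e i) := by
        unfold rho
        rcases max_choice (d s (s + e 0)) (max (d s (s + e 1)) (d s (s + e 2))) with h | h
        · exact ⟨0, h⟩
        · rw [h]
          rcases max_choice (d s (s + e 1)) (d s (s + e 2)) with h | h
          · exact ⟨1, h⟩
          · exact ⟨2, h⟩
      obtain ⟨i, hi⟩ := e1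
      by_cases hic : i = c s
      · rw [hi, hic]
      · have := b i hic
        linarith
    have hge : d s (s + e (c s)) ≤ rho d s := by
      unfold rho
      generalize c s = i
      fin_cases i <;> simp
    exact ⟨le_antisymm hle hge, a.trans hle⟩
  have H : ColData d lam S c := by
    refine ⟨hc1, hc2, ?_⟩
    intro s hs t ht hst k hk1 hk2
    obtain ⟨i, hi⟩ := hc s t
    have hst' := mul_le_mul_of_nonneg_left (hD s hs t ht) h0.le
    rcases dir_cases (c s) (c t) k i hst hk1 hk2 with h | h | h
    · exfalso
      subst h
      have a := hD s hs _ (hc2 t ht (c s) hst)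
      have b := tr s (t + e (c s)) (s + e (c s))
      have := sy (t + e (c s)) (s + e (c s))
      have := (hrho s hs).2
      linarith
    · exfalso
      subst h
      have a := hD t ht _ (hc2 s hs (c t) (Ne.symm hst))
      have b := tr t (s + e (c t)) (t + e (c t))
      have := (hrho t ht).2
      linarith
    · rw [← h]; exact hi
  obtain ⟨r, hr⟩ := mono_all hd h0 h1 hno H hne hD
  have hin : ∀ s ∈ S, ∀ j, j ≠ r → s + e j ∈ S := by
    intro s hs j hj
    exact hc2 s hs j (by rw [hr s hs]; exact hj)
  have hbig : ∀ s ∈ S, R ≤ d s (s + e r) := by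
    intro s hs
    have := (hrho s hs).2
    rwa [hr s hs] at this
  have hRpos : 0 < R := by linarith
  obtain ⟨s0, hs0, hρ⟩ : ∃ s ∈ S, d s (s + e r) < 11/10 * R := by
    by_contra h
    push Not at h
    have : 11/10 * R ≤ R := by
      apply hR.2
      rintro _ ⟨s, hs, rfl⟩
      rw [(hrho s hs).1, hr s hs]
      exact h s hs
    linarith
  have hρR := hbig s0 hs0
  generalize hp : d s0 (s0 + e r) = p at hρ hρR
  have hlp : lam * p ≤ 1/9 * (11/10 * R) := by
    apply mul_le_mul h1.le hρ.le <;> linarith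
  have hlD2 : lam * D ≤ 1/9 * D := mul_le_mul_of_nonneg_right h1.le hD0
  have base : ∀ s ∈ S, d (s + e r) (s0 + e r + e r) ≤ lam * d s (s0 + e r) := by
    intro s hs
    obtain ⟨i, hi⟩ := hc s (s0 + e r)
    by_cases hir : i = r
    · rwa [hir] at hi
    · exfalso
      have a := hD _ (hin s0 hs0 i hir) _ (hin s hs i hir)
      have b := hbig _ (hin s0 hs0 i hir)
      have t1 := tr (s0 + e i) (s + e i) (s0 + e r + e i)
      rw [add_right_comm s0 (e i)] at b
      have t2 : d s (s0 + e r) ≤ D + p := by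
        have := tr s s0 (s0 + e r)
        have := hD s hs s0 hs0
        linarith
      have t3 := mul_le_mul_of_nonneg_left t2 h0.le
      linarith
  have hC : ∀ s ∈ S, d (s + e r) (s0 + e r) ≤ lam * (D + 2 * p) := by
    intro s hs
    have a := base s hs
    have b := base s0 hs0
    rw [hp] at b
    have t2 : d s (s0 + e r) ≤ D + p := by
      have := tr s s0 (s0 + e r)
      have := hD s hs s0 hs0
      linarith
    have t3 := mul_le_mul_of_nonneg_left t2 h0.le
    have := tr (s + e r) (s0 + e r + e r) (s0 + e r)
    have := sy (s0 + e r + e r) (s0 + e r)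
    linarith
  generalize hCdef : lam * (D + 2 * p) = C at hC
  have hCR : C ≤ 3/10 * R := by
    rw [← hCdef]; nlinarith
  have hC0 : 0 ≤ C := by rw [← hCdef]; exact mul_nonneg h0.le (by linarith)
  have hlC : lam * C ≤ 1/9 * C := mul_le_mul_of_nonneg_right h1.le hC0
  have all : ∀ m : ℕ, ∀ s ∈ S, d (s + e r + m • e r) (s0 + e r) ≤ C := by
    intro m
    induction m with
    | zero => simpa using hC
    | succ m ih =>
      intro s hs
      rw [succ_nsmul, ← add_assoc]
      have hdist : d (s + e r + m • e r) s0 ≤ p + C := by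
        have := ih s hs
        have := tr (s + e r + m • e r) (s0 + e r) s0
        have := sy s0 (s0 + e r)
        linarith
      have hdist2 := mul_le_mul_of_nonneg_left hdist h0.le
      obtain ⟨i, hi⟩ := hc (s + e r + m • e r) s0
      by_cases hir : i = r
      · rw [hir] at hi
        have : lam * (p + C) ≤ C := by
          conv_rhs => rw [← hCdef]
          apply mul_le_mul_of_nonneg_left _ h0.le
          linarith
        linarith
      · exfalso
        have a := ih _ (hin s hs i hir)
        have b := hC _ (hin s0 hs0 i hir)
        have g := hbig _ (hin s0 hs0 i hir)
        have e1 : s + e r + m • e r + e i = s + e i + e r + m • e r := by abel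
        rw [e1] at hi
        have t1 := tr (s0 + e i) (s + e i + e r + m • e r) (s0 + e i + e r)
        have t2 := tr (s + e i + e r + m • e r) (s0 + e r) (s0 + e i + e r)
        have := sy (s0 + e i) (s + e i + e r + m • e r)
        have := sy (s0 + e r) (s0 + e i + e r)
        linarith
  have hQ : ∀ k : Grid, d (s0 + e r + k) (s0 + e r) ≤ C := by
    intro k
    obtain ⟨s, hs, m, hm⟩ := grid_induct (fun x => ∃ s ∈ S, ∃ m : ℕ, x = s + e r + m • e r)
      (by
        rintro x ⟨s, hs, m, rfl⟩ i
        by_cases hir : i = r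
        · exact ⟨s, hs, m+1, by rw [hir, succ_nsmul, ← add_assoc]⟩
        · exact ⟨s + e i, hin s hs i hir, m, by abel⟩)
      (s0 + e r) ⟨s0, hs0, 0, by simp⟩ k
    rw [hm]
    exact all m s hs
  refine ⟨s0 + e r, fun k k' => ?_⟩
  have := hQ k
  have := hQ k'
  have := tr (s0 + e r + k) (s0 + e r) (s0 + e r + k')
  have := sy (s0 + e r) (s0 + e r + k')
  have : lam * (D + 2 * p) ≤ lam * (3 * R) := by
    apply mul_le_mul_of_nonneg_left _ h0.le
    linarith
  linarith
end
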